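/- arXiv:1106.2302 — 2 statements merged into one kernel-verified Lean document; each statement's English description precedes it below -/
import Mathlib

section
/- Let 0 < H < 1/2, let f: ℝ → ℝ be C¹ with compact support, and let (X,Y) be a centered Gaussian vector with Var(X) = s^(2H), Var(Y) = r^(2H) (s > r > 0) and Cov(X,Y) = μ = (1/2)(s^(2H)+r^(2H)-(s-r)^(2H)). Then there is a constant C depending only on H such that |E[f'(X) f'(Y)]| ≤ C * s^H / (r^H (s-r)^(2H)) * (E[f(X)²] E[f(Y)²])^(1/2). -/
open MeasureTheory Real
lemma amgm_opt (x A B : ℝ) (hx : 0 ≤ x) (hA : 0 ≤ A) (hB : 0 ≤ B)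
    (h : ∀ l : ℝ, 0 < l → x ≤ l * A + l⁻¹ * B) : x ≤ 2 * √(A * B) := by
  have h1 : ∀ l : ℝ, 0 ≤ A * (l * l) + (-x) * l + B := by
    intro l
    rcases le_or_gt l 0 with hl | hl
    · nlinarith [mul_nonneg hA (mul_self_nonneg l), mul_nonneg hx (neg_nonneg.2 hl)]
    · have := h l hl
      have h2 := mul_le_mul_of_nonneg_left this hl.le
      have h3 : l * (l * A + l⁻¹ * B) = A * (l * l) + B := by field_simp
      linarith
  have h2 := discrim_le_zero h1
  unfold discrim at h2
  have h3 : x / 2 ≤ √(A * B) := by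
    apply Real.le_sqrt_of_sq_le
    nlinarith
  linarith

lemma rp_aux (H x y : ℝ) (hH0 : 0 < H) (hH1 : H < 1) (hy : 0 < y) (hxy : y ≤ x) :
    (x + y) ^ H ≤ x ^ H + H * y ^ H := by
  have hx : 0 < x := by linarith
  have e1 : x + y = x * (1 + y / x) := by field_simp
  have h1 : (1 + y / x) ^ H ≤ 1 + H * (y / x) :=
    rpow_one_add_le_one_add_mul_self (by have := div_pos hy hx; linarith) hH0.le hH1.le
  have h2 : x ^ H * (y / x) ≤ y ^ H := by
    have h3 : y / x ≤ (y / x) ^ H := by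
      have := Real.rpow_le_rpow_of_exponent_ge (div_pos hy hx) ((div_le_one hx).2 hxy) hH1.le
      simpa using this
    calc x ^ H * (y / x) ≤ x ^ H * (y / x) ^ H := by gcongr
      _ = y ^ H := by
        rw [← Real.mul_rpow hx.le (div_pos hy hx).le]; congr 1; field_simp
  rw [e1, Real.mul_rpow hx.le (by positivity)]
  have h4 : x ^ H * (1 + y / x) ^ H ≤ x ^ H * (1 + H * (y / x)) := by gcongr
  nlinarith

lemma rho_lb (H s r : ℝ) (hH0 : 0 < H) (hH1 : H < 1) (hr : 0 < r) (hs : r < s) :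
    (1 - H) / 4 * ((r ^ H) ^ 2 * ((s - r) ^ H) ^ 2) ≤ (s ^ H) ^ 2 * (r ^ H) ^ 2 -
      ((1/2) * ((s ^ H) ^ 2 + (r ^ H) ^ 2 - ((s - r) ^ H) ^ 2)) ^ 2 := by
  have hd : 0 < s - r := by linarith
  have hp : 0 < s ^ H := Real.rpow_pos_of_pos (by linarith) _
  have hq : 0 < r ^ H := Real.rpow_pos_of_pos (by linarith) _
  have ht : 0 < (s - r) ^ H := Real.rpow_pos_of_pos (by linarith) _
  have hqp : r ^ H ≤ s ^ H := Real.rpow_le_rpow hr.le hs.le hH0.le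
  have htp : (s - r) ^ H ≤ s ^ H := Real.rpow_le_rpow hd.le (by linarith) hH0.le
  have key : (1 - H) * (r ^ H * (s - r) ^ H) ≤ ((s - r) ^ H + r ^ H - s ^ H) * s ^ H := by
    rcases le_total r (s - r) with h | h
    · have := rp_aux H (s - r) r hH0 hH1 hr h
      rw [show s - r + r = s by ring] at this
      calc (1 - H) * (r ^ H * (s - r) ^ H) = ((1 - H) * r ^ H) * (s - r) ^ H := by ring
        _ ≤ _ := by
          apply mul_le_mul (by linarith) htp ht.le
          nlinarith [mul_pos (sub_pos.2 hH1) hq]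
    · have := rp_aux H r (s - r) hH0 hH1 hd h
      rw [show r + (s - r) = s by ring] at this
      calc (1 - H) * (r ^ H * (s - r) ^ H) = ((1 - H) * (s - r) ^ H) * r ^ H := by ring
        _ ≤ _ := by
          apply mul_le_mul (by linarith) hqp hq.le
          nlinarith [mul_pos (sub_pos.2 hH1) ht]
  generalize s ^ H = p at *
  generalize r ^ H = q at *
  generalize (s - r) ^ H = t at *
  have hk0 : 0 ≤ t + q - p := by
    by_contra hc
    push Not at hc
    nlinarith [mul_pos (sub_pos.2 hH1) (mul_pos hq ht), mul_pos hp (neg_pos.2 hc)]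
  have e : p ^ 2 * q ^ 2 - ((1/2) * (p ^ 2 + q ^ 2 - t ^ 2)) ^ 2 =
      1/4 * ((t + q - p) * (p + q + t) * ((t + p - q) * (p + q - t))) := by ring
  rw [e]
  have h1 : (1 - H) * (q * t) ≤ (t + q - p) * (p + q + t) := key.trans (by gcongr; linarith)
  have h2 : q * t ≤ (t + p - q) * (p + q - t) := by
    rw [mul_comm]; apply mul_le_mul <;> linarith
  have h3 := mul_le_mul h1 h2 (by positivity) (mul_nonneg hk0 (by positivity))
  nlinarith

lemma gauss_mom (m : ℝ) (v : NNReal) (hv : v ≠ 0) :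
    Integrable (fun y => ((y - m) ^ 2 / v + 1) * ProbabilityTheory.gaussianPDFReal m v y) ∧
    ∫ y, ((y - m) ^ 2 / v + 1) * ProbabilityTheory.gaussianPDFReal m v y = 2 := by
  have hv' : (v : ℝ) ≠ 0 := by exact_mod_cast hv
  have hm : MemLp (fun y : ℝ => y) 2 (ProbabilityTheory.gaussianReal m v) :=
    ProbabilityTheory.memLp_id_gaussianReal' 2 (by simp)
  have hi : Integrable (fun y : ℝ => (y - m) ^ 2) (ProbabilityTheory.gaussianReal m v) :=
    (hm.sub (memLp_const m)).integrable_sq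
  have hi2 : Integrable (fun y : ℝ => (y - m) ^ 2 / v + 1) (ProbabilityTheory.gaussianReal m v) :=
    (hi.div_const _).add (integrable_const _)
  have hvar := ProbabilityTheory.variance_fun_id_gaussianReal (μ := m) (v := v)
  rw [ProbabilityTheory.variance_eq_integral (by fun_prop)] at hvar
  rw [ProbabilityTheory.integral_id_gaussianReal] at hvar
  have hint : ∫ y, ((y - m) ^ 2 / v + 1) ∂(ProbabilityTheory.gaussianReal m v) = 2 := by
    rw [integral_add (hi.div_const _) (integrable_const _), integral_div, hvar]
    simp [hv']; norm_num
  constructor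
  · rw [ProbabilityTheory.gaussianReal_of_var_ne_zero _ hv,
      integrable_withDensity_iff (ProbabilityTheory.measurable_gaussianPDF m v)
      (Filter.Eventually.of_forall fun _ => ProbabilityTheory.gaussianPDF_lt_top)] at hi2
    simpa [ProbabilityTheory.toReal_gaussianPDF] using hi2
  · rw [ProbabilityTheory.integral_gaussianReal_eq_integral_smul hv] at hint
    rw [← hint]
    congr 1; ext y; simp [mul_comm]

noncomputable def PH (p q μ ρ x y : ℝ) : ℝ := (1/(2*π*ρ)) *
          Real.exp (-(1/(2*ρ^2)) * (q ^ 2 * x^2 - 2*μ*x*y + p ^ 2 * y^2))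

noncomputable def gg (p x : ℝ) : ℝ := (1/(Real.sqrt (2*π) * p)) * Real.exp (-x^2 / (2 * p ^ 2))

lemma PH_symm (p q μ ρ x y : ℝ) : PH p q μ ρ x y = PH q p μ ρ y x := by
  unfold PH; congr 3; ring

lemma PH_pos (p q μ ρ x y : ℝ) (hρ : 0 < ρ) : 0 < PH p q μ ρ x y := by
  unfold PH; positivity

lemma PH_cont (p q μ ρ : ℝ) : Continuous (fun z : ℝ × ℝ => PH p q μ ρ z.1 z.2) := by
  unfold PH; fun_prop

lemma PH_fac (p q μ ρ x y : ℝ) (hp : 0 < p) (hρ : 0 < ρ) (hD : ρ ^ 2 = p ^ 2 * q ^ 2 - μ ^ 2)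
    (v : NNReal) (hv : (v : ℝ) = ρ ^ 2 / p ^ 2) :
    PH p q μ ρ x y = gg p x * ProbabilityTheory.gaussianPDFReal (μ * x / p ^ 2) v y := by
  unfold PH gg ProbabilityTheory.gaussianPDFReal
  have e1 : √(2 * π * v) = √(2 * π) * (ρ / p) := by
    rw [hv, Real.sqrt_mul (by positivity), ← div_pow, Real.sqrt_sq (by positivity)]
  have e2 : 1 / (2 * π * ρ) = 1/(√(2*π) * p) * (√(2 * π * v))⁻¹ := by
    rw [e1]
    have : √(2 * π) * √(2 * π) = 2 * π := Real.mul_self_sqrt (by positivity)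
    have h0 : √(2 * π) ≠ 0 := by positivity
    nth_rewrite 1 [← this]
    field_simp
  rw [e2, hv]
  have e3 : -(1/(2*ρ^2)) * (q ^ 2 * x^2 - 2*μ*x*y + p ^ 2 * y^2) =
      -x^2 / (2 * p ^ 2) + -(y - μ * x / p ^ 2) ^ 2 / (2 * (ρ ^ 2 / p ^ 2)) := by
    have h1 : q ^ 2 = (ρ ^ 2 + μ ^ 2) / p ^ 2 := by rw [hD]; field_simp; ring
    rw [h1]; field_simp; ring
  rw [e3, Real.exp_add]; ring

lemma PH_inner (p q μ ρ x : ℝ) (hp : 0 < p) (hρ : 0 < ρ) (hD : ρ ^ 2 = p ^ 2 * q ^ 2 - μ ^ 2) :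
    Integrable (fun y => ((p ^ 2 * y - μ * x) ^ 2 / (p ^ 2 * ρ ^ 2) + 1) * PH p q μ ρ x y) ∧
    ∫ y, ((p ^ 2 * y - μ * x) ^ 2 / (p ^ 2 * ρ ^ 2) + 1) * PH p q μ ρ x y = 2 * gg p x := by
  let v : NNReal := ⟨ρ ^ 2 / p ^ 2, by positivity⟩
  have hv : (v : ℝ) = ρ ^ 2 / p ^ 2 := rfl
  have hv0 : v ≠ 0 := by
    intro h
    have : (v : ℝ) = 0 := by rw [h]; rfl
    rw [hv] at this
    have : 0 < ρ ^ 2 / p ^ 2 := by positivity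
    linarith
  have e : (fun y => ((p ^ 2 * y - μ * x) ^ 2 / (p ^ 2 * ρ ^ 2) + 1) * PH p q μ ρ x y) =
    fun y => gg p x * (((y - μ * x / p ^ 2) ^ 2 / v + 1) *
      ProbabilityTheory.gaussianPDFReal (μ * x / p ^ 2) v y) := by
    ext y
    rw [PH_fac p q μ ρ x y hp hρ hD v hv, hv]
    have : (p ^ 2 * y - μ * x) ^ 2 / (p ^ 2 * ρ ^ 2) =
      (y - μ * x / p ^ 2) ^ 2 / (ρ ^ 2 / p ^ 2) := by field_simp
    rw [this]; ring
  obtain ⟨h1, h2⟩ := gauss_mom (μ * x / p ^ 2) v hv0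
  rw [e]
  refine ⟨h1.const_mul _, ?_⟩
  rw [integral_const_mul, h2, mul_comm]

lemma PH_outer (p q μ ρ : ℝ) (hp : 0 < p) (hρ : 0 < ρ) (hD : ρ ^ 2 = p ^ 2 * q ^ 2 - μ ^ 2)
    (f : ℝ → ℝ) (hf : Continuous f) (hc : HasCompactSupport f) :
    Integrable (fun z : ℝ × ℝ => f z.1 ^ 2 * (((p ^ 2 * z.2 - μ * z.1) ^ 2 / (p ^ 2 * ρ ^ 2) + 1) *
      PH p q μ ρ z.1 z.2)) ∧
    ∫ z : ℝ × ℝ, f z.1 ^ 2 * (((p ^ 2 * z.2 - μ * z.1) ^ 2 / (p ^ 2 * ρ ^ 2) + 1) *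
      PH p q μ ρ z.1 z.2) = 2 * ∫ x, f x ^ 2 * gg p x := by
  have hi := fun x => PH_inner p q μ ρ x hp hρ hD
  have hcont := PH_cont p q μ ρ
  have hI : Integrable (fun z : ℝ × ℝ => f z.1 ^ 2 *
      (((p ^ 2 * z.2 - μ * z.1) ^ 2 / (p ^ 2 * ρ ^ 2) + 1) * PH p q μ ρ z.1 z.2))
      (volume.prod volume) := by
    rw [integrable_prod_iff (Continuous.aestronglyMeasurable (by fun_prop))]
    refine ⟨Filter.Eventually.of_forall fun x => (hi x).1.const_mul (f x ^ 2), ?_⟩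
    have e : (fun x => ∫ y, ‖f x ^ 2 *
      (((p ^ 2 * y - μ * x) ^ 2 / (p ^ 2 * ρ ^ 2) + 1) * PH p q μ ρ x y)‖) =
      fun x => f x ^ 2 * (2 * gg p x) := by
      ext x
      rw [← (hi x).2, ← integral_const_mul]
      congr 1; ext y
      rw [Real.norm_of_nonneg]
      have := PH_pos p q μ ρ x y hρ
      positivity
    simp only [e]
    apply Continuous.integrable_of_hasCompactSupport
    · unfold gg; fun_prop
    · apply HasCompactSupport.mul_right
      exact hc.comp_left (g := fun t : ℝ => t ^ 2) (by simp)
  refine ⟨hI, ?_⟩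
  rw [Measure.volume_eq_prod, integral_prod _ hI, ← integral_const_mul]
  congr 1; ext x
  simp only
  rw [integral_const_mul, (hi x).2]; ring

lemma ibp1 (f u u' : ℝ → ℝ) (hf : ContDiff ℝ 1 f) (hc : HasCompactSupport f)
    (hu : ∀ x, HasDerivAt u (u' x) x) (hu' : Continuous u') :
    ∫ x, deriv f x * u x = - ∫ x, f x * u' x := by
  have hcu : Continuous u := continuous_iff_continuousAt.2 fun x => (hu x).continuousAt
  have hcf' : Continuous (deriv f) := hf.continuous_deriv le_rfl
  have h := integral_mul_deriv_eq_deriv_mul_of_integrable (u := f) (v := u) (u' := deriv f)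
    (v' := u') (fun x _ => (hf.differentiable one_ne_zero x).hasDerivAt) (fun x _ => hu x)
    ((hf.continuous.mul hu').integrable_of_hasCompactSupport hc.mul_right)
    ((hcf'.mul hcu).integrable_of_hasCompactSupport hc.deriv.mul_right)
    ((hf.continuous.mul hcu).integrable_of_hasCompactSupport hc.mul_right)
  rw [h, neg_neg]

lemma cs_int (g h : ℝ → ℝ) (W : ℝ × ℝ → ℝ) (hg : Continuous g) (hh : Continuous h)
    (hW : Continuous W) (hcg : HasCompactSupport g) (hch : HasCompactSupport h) :
    Integrable (fun z : ℝ × ℝ => g z.1 * h z.2 * W z) (volume.prod volume) := by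
  apply Continuous.integrable_of_hasCompactSupport (by fun_prop)
  apply HasCompactSupport.intro (IsCompact.prod hcg hch)
  rintro ⟨x, y⟩ hz
  rw [Set.mem_prod, not_and_or] at hz
  rcases hz with hz | hz
  · simp [image_eq_zero_of_notMem_tsupport hz]
  · simp [image_eq_zero_of_notMem_tsupport hz]

lemma PH_dy (p q μ ρ x y : ℝ) (hρ : 0 < ρ) : HasDerivAt (fun y => PH p q μ ρ x y)
    (-((p ^ 2 * y - μ * x) / ρ ^ 2) * PH p q μ ρ x y) y := by
  unfold PH
  have h1 : HasDerivAt (fun y : ℝ => -(1/(2*ρ^2)) * (q ^ 2 * x^2 - 2*μ*x*y + p ^ 2 * y^2))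
      (-(1/(2*ρ^2)) * (0 - 2*μ*x*1 + p ^ 2 * (2 * y))) y := by
    have a := (hasDerivAt_id y).const_mul (2*μ*x)
    have b := ((hasDerivAt_pow 2 y)).const_mul (p ^ 2)
    have c := (((hasDerivAt_const y (q ^ 2 * x ^ 2)).sub a).add b).const_mul (-(1/(2*ρ^2)))
    simpa using c
  refine (h1.exp.const_mul (1/(2*π*ρ))).congr_deriv ?_
  field_simp; ring

lemma ibp2 (p q μ ρ : ℝ) (hρ : 0 < ρ) (f : ℝ → ℝ) (hf : ContDiff ℝ 1 f)
    (hc : HasCompactSupport f) :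
    ∫ x, ∫ y, deriv f x * deriv f y * PH p q μ ρ x y =
    ∫ z : ℝ × ℝ, f z.1 * f z.2 * (((q ^ 2 * z.1 - μ * z.2) * (p ^ 2 * z.2 - μ * z.1) / ρ ^ 4
      + μ / ρ ^ 2) * PH p q μ ρ z.1 z.2) := by
  have hcont := PH_cont p q μ ρ
  have hcf := hf.continuous
  have hcf' : Continuous (deriv f) := hf.continuous_deriv le_rfl
  have hcx : ∀ x, Continuous fun y => PH p q μ ρ x y := fun x => by unfold PH; fun_prop
  have hcy : ∀ y, Continuous fun x => PH p q μ ρ x y := fun x => by unfold PH; fun_prop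
  have s1 : ∀ x, ∫ y, deriv f x * deriv f y * PH p q μ ρ x y =
      ∫ y, deriv f x * f y * ((p ^ 2 * y - μ * x) / ρ ^ 2 * PH p q μ ρ x y) := by
    intro x
    simp only [mul_assoc]
    rw [integral_const_mul, integral_const_mul]
    have := hcx x
    rw [ibp1 f _ _ hf hc (fun y => PH_dy p q μ ρ x y hρ) (by fun_prop), ← integral_neg]
    congr 2; ext y; ring
  simp only [s1]
  rw [integral_integral_swap (cs_int (deriv f) f
    (fun z => (p ^ 2 * z.2 - μ * z.1) / ρ ^ 2 * PH p q μ ρ z.1 z.2) hcf' hcf (by fun_prop)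
    hc.deriv hc)]
  have hI := cs_int f f
    (fun z => ((q ^ 2 * z.1 - μ * z.2) * (p ^ 2 * z.2 - μ * z.1) / ρ ^ 4
      + μ / ρ ^ 2) * PH p q μ ρ z.1 z.2) hcf hcf (by fun_prop) hc hc
  rw [Measure.volume_eq_prod, integral_prod_symm _ hI]
  congr 1; ext y
  have hd : ∀ x, HasDerivAt (fun x => (p ^ 2 * y - μ * x) / ρ ^ 2 * PH p q μ ρ x y)
      (-(((q ^ 2 * x - μ * y) * (p ^ 2 * y - μ * x) / ρ ^ 4
      + μ / ρ ^ 2) * PH p q μ ρ x y)) x := by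
    intro x
    have a : HasDerivAt (fun x => (p ^ 2 * y - μ * x) / ρ ^ 2) (-μ / ρ ^ 2) x := by
      have := (((hasDerivAt_id x).const_mul μ).const_sub (p ^ 2 * y)).div_const (ρ ^ 2)
      simpa using this
    have b := PH_dy q p μ ρ y x hρ
    simp only [← PH_symm p q μ ρ] at b
    refine (a.mul b).congr_deriv ?_
    field_simp; ring
  have := hcy y
  have h := ibp1 f _ _ hf hc hd (by fun_prop)
  calc ∫ x, deriv f x * f y * ((p ^ 2 * y - μ * x) / ρ ^ 2 * PH p q μ ρ x y)
      = f y * ∫ x, deriv f x * ((p ^ 2 * y - μ * x) / ρ ^ 2 * PH p q μ ρ x y) := by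
        rw [← integral_const_mul]; congr 1; ext x; ring
    _ = _ := by
        rw [h, ← integral_neg, ← integral_const_mul]; congr 1; ext x; ring

lemma pw (p q μ ρ x y α β l : ℝ) (hp : 0 < p) (hq : 0 < q) (hρ : 0 < ρ) (hl : 0 < l)
    (hμ : |μ| ≤ p * q) :
    |α * β * ((q ^ 2 * x - μ * y) * (p ^ 2 * y - μ * x) / ρ ^ 4 + μ / ρ ^ 2)| ≤
    p * q / ρ ^ 2 * (1/2) * (l * (α ^ 2 * ((p ^ 2 * y - μ * x) ^ 2 / (p ^ 2 * ρ ^ 2) + 1)) +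
      l⁻¹ * (β ^ 2 * ((q ^ 2 * x - μ * y) ^ 2 / (q ^ 2 * ρ ^ 2) + 1))) := by
  generalize hV : p ^ 2 * y - μ * x = V
  generalize hU : q ^ 2 * x - μ * y = U
  have am : ∀ a b : ℝ, |a * b| ≤ (1/2) * (l * a ^ 2 + l⁻¹ * b ^ 2) := by
    intro a b
    have h := sq_nonneg (l * |a| - |b|)
    have e : (1/2) * (l * a ^ 2 + l⁻¹ * b ^ 2) - |a * b| = (1/2) * l⁻¹ * (l * |a| - |b|) ^ 2 := by
      rw [abs_mul, ← sq_abs a, ← sq_abs b]; field_simp; ring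
    have : 0 ≤ (1/2) * l⁻¹ * (l * |a| - |b|) ^ 2 := by positivity
    linarith
  have e1 : α * β * (U * V / ρ ^ 4 + μ / ρ ^ 2) =
      p * q / ρ ^ 2 * ((α * (V / (p * ρ))) * (β * (U / (q * ρ)))) + μ / ρ ^ 2 * (α * β) := by
    field_simp
  rw [e1]
  have h1 := am (α * (V / (p * ρ))) (β * (U / (q * ρ)))
  have h2 := am α β
  have hk : 0 < p * q / ρ ^ 2 := by positivity
  calc _ ≤ p * q / ρ ^ 2 * |(α * (V / (p * ρ))) * (β * (U / (q * ρ)))| +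
        p * q / ρ ^ 2 * |α * β| := by
        refine (abs_add_le _ _).trans ?_
        rw [abs_mul, abs_mul (μ / ρ ^ 2), abs_of_pos hk, abs_div, abs_of_pos (by positivity : 0 < ρ ^ 2)]
        gcongr
    _ ≤ _ := by
        have := mul_le_mul_of_nonneg_left (add_le_add h1 h2) hk.le
        rw [mul_add] at this
        refine this.trans (le_of_eq ?_)
        field_simp; ring

lemma main_bd (p q μ ρ : ℝ) (hp : 0 < p) (hq : 0 < q) (hρ : 0 < ρ)
    (hD : ρ ^ 2 = p ^ 2 * q ^ 2 - μ ^ 2) (f : ℝ → ℝ) (hf : ContDiff ℝ 1 f)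
    (hc : HasCompactSupport f) :
    |∫ x, ∫ y, deriv f x * deriv f y * PH p q μ ρ x y| ≤
    2 * (p * q / ρ ^ 2) * √((∫ x, f x ^ 2 * gg p x) * (∫ y, f y ^ 2 * gg q y)) := by
  have hμ : |μ| ≤ p * q := by
    apply abs_le_of_sq_le_sq _ (by positivity)
    nlinarith [sq_nonneg ρ]
  have hA := PH_outer p q μ ρ hp hρ hD f hf.continuous hc
  have hB := PH_outer q p μ ρ hq hρ (by rw [hD]; ring) f hf.continuous hc
  obtain ⟨hA1, hA2⟩ := hA
  obtain ⟨hB1, hB2⟩ := hB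
  have hB3 := hB1.swap
  have hB4 := integral_prod_swap (μ := (volume : Measure ℝ)) (ν := (volume : Measure ℝ))
    (fun z : ℝ × ℝ => f z.1 ^ 2 * (((q ^ 2 * z.2 - μ * z.1) ^ 2 / (q ^ 2 * ρ ^ 2) + 1) *
      PH q p μ ρ z.1 z.2))
  rw [← Measure.volume_eq_prod, hB2] at hB4
  simp only [Function.comp_def, Prod.fst_swap, Prod.snd_swap, ← PH_symm p q] at hB3 hB4
  rw [← Measure.volume_eq_prod] at hB3
  rw [ibp2 p q μ ρ hρ f hf hc]
  have hk : 0 < p * q / ρ ^ 2 := by positivity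
  have hg : ∀ p : ℝ, 0 < p → 0 ≤ ∫ x, f x ^ 2 * gg p x := by
    intro p hp
    apply integral_nonneg
    intro x
    unfold gg
    positivity
  have hcont := PH_cont p q μ ρ
  have hcf := hf.continuous
  have key := amgm_opt (|∫ z : ℝ × ℝ, f z.1 * f z.2 *
      (((q ^ 2 * z.1 - μ * z.2) * (p ^ 2 * z.2 - μ * z.1) / ρ ^ 4
      + μ / ρ ^ 2) * PH p q μ ρ z.1 z.2)| / (p * q / ρ ^ 2)) _ _ (by positivity)
      (hg p hp) (hg q hq) ?_
  · rw [div_le_iff₀ hk] at key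
    linarith
  intro l hl
  rw [div_le_iff₀ hk]
  have hR := ((hA1.const_mul l).add (hB3.const_mul l⁻¹)).const_mul (p * q / ρ ^ 2 * (1/2))
  have hle := norm_integral_le_of_norm_le (f := fun z : ℝ × ℝ => f z.1 * f z.2 *
      (((q ^ 2 * z.1 - μ * z.2) * (p ^ 2 * z.2 - μ * z.1) / ρ ^ 4
      + μ / ρ ^ 2) * PH p q μ ρ z.1 z.2)) hR (Filter.Eventually.of_forall ?_)
  · rw [Real.norm_eq_abs] at hle
    refine hle.trans (le_of_eq ?_)
    rw [integral_const_mul]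
    simp only [Pi.add_apply]
    rw [integral_add (hA1.const_mul l) (hB3.const_mul l⁻¹), integral_const_mul,
      integral_const_mul, hA2, hB4]
    ring
  · rintro ⟨x, y⟩
    have h := pw p q μ ρ x y (f x) (f y) l hp hq hρ hl hμ
    have hφ := PH_pos p q μ ρ x y hρ
    have h2 := mul_le_mul_of_nonneg_right h hφ.le
    simp only [Pi.add_apply]
    rw [← mul_assoc, norm_mul, Real.norm_of_nonneg hφ.le, Real.norm_eq_abs]
    refine h2.trans (le_of_eq ?_)
    ring



theorem stmt15 (H : ℝ) (hH0 : 0 < H) (hH1 : H < 1/2) :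
    ∃ C : ℝ, 0 < C ∧ ∀ s r : ℝ, 0 < r → r < s →
      ∀ f : ℝ → ℝ, ContDiff ℝ 1 f → HasCompactSupport f →
      ∀ μ ρ : ℝ, μ = (1/2) * (s ^ (2*H) + r ^ (2*H) - (s - r) ^ (2*H)) →
        ρ = Real.sqrt (s ^ (2*H) * r ^ (2*H) - μ^2) →
      ∀ φ : ℝ → ℝ → ℝ,
        (∀ x y, φ x y = (1/(2*π*ρ)) *
          Real.exp (-(1/(2*ρ^2)) * (r ^ (2*H) * x^2 - 2*μ*x*y + s ^ (2*H) * y^2))) →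
      |∫ x : ℝ, ∫ y : ℝ, deriv f x * deriv f y * φ x y|
        ≤ C * s ^ H / (r ^ H * (s - r) ^ (2*H)) *
          Real.sqrt
            ((∫ x : ℝ, (f x)^2 * ((1/(Real.sqrt (2*π) * s ^ H)) * Real.exp (-x^2 / (2 * s ^ (2*H))))) *
             (∫ y : ℝ, (f y)^2 * ((1/(Real.sqrt (2*π) * r ^ H)) * Real.exp (-y^2 / (2 * r ^ (2*H)))))) := by
  
  refine ⟨8 / (1 - H), by apply div_pos <;> linarith, ?_⟩
  intro s r hr hs f hf hc μ ρ hμ hρ φ hφ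
  have hs0 : 0 < s := by linarith
  have hd : 0 < s - r := by linarith
  have e2 : ∀ t : ℝ, 0 < t → t ^ (2 * H) = (t ^ H) ^ 2 := by
    intro t ht
    rw [← Real.rpow_natCast, ← Real.rpow_mul ht.le]; congr 1; push_cast; ring
  have hlb := rho_lb H s r hH0 (by linarith) hr hs
  rw [e2 s hs0, e2 r hr] at hρ
  simp only [e2 s hs0, e2 r hr, e2 _ hd] at hμ hφ ⊢
  rw [← hμ] at hlb
  have hp : 0 < s ^ H := Real.rpow_pos_of_pos hs0 _
  have hq : 0 < r ^ H := Real.rpow_pos_of_pos hr _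
  have ht : 0 < (s - r) ^ H := Real.rpow_pos_of_pos hd _
  generalize s ^ H = p at *
  generalize r ^ H = q at *
  generalize (s - r) ^ H = t at *
  have h1H : 0 < 1 - H := by linarith
  have hlb0 : 0 < (1 - H) / 4 * (q ^ 2 * t ^ 2) := by positivity
  have hρ0 : 0 < ρ := by rw [hρ]; exact Real.sqrt_pos.2 (by linarith)
  have hD : ρ ^ 2 = p ^ 2 * q ^ 2 - μ ^ 2 := by
    rw [hρ]; exact Real.sq_sqrt (by linarith)
  have hb := main_bd p q μ ρ hp hq hρ0 hD f hf hc
  have hφ' : φ = PH p q μ ρ := by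
    ext x y; rw [hφ]; rfl
  rw [hφ']
  refine hb.trans ?_
  unfold gg
  apply mul_le_mul_of_nonneg_right _ (Real.sqrt_nonneg _)
  rw [← hD] at hlb
  calc 2 * (p * q / ρ ^ 2) ≤ 2 * (p * q / ((1 - H) / 4 * (q ^ 2 * t ^ 2))) := by gcongr
    _ = _ := by field_simp; norm_num
end

section
/- Let 0 < H < 1/2, let f: ℝ → ℝ be C² with compact support, and let (X,Y) be a centered Gaussian vector with Var(X) = s^(2H), Var(Y) = r^(2H) (s > r > 0) and Cov(X,Y) = μ = (1/2)(s^(2H)+r^(2H)-(s-r)^(2H)). Then there is a constant C depending only on H such that |E[f''(X) f(Y)]| ≤ C / (s-r)^(2H) * (E[f(X)²] E[f(Y)²])^(1/2). -/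
open MeasureTheory Real

lemma aux_conc {H u v : ℝ} (hH0 : 0 < H) (hH1 : H < 1) (hu : 0 < u) (huv : u ≤ v) :
    (2 - 2 ^ H) * u ^ H ≤ u ^ H + v ^ H - (u+v) ^ H := by
  have hc := (Real.concaveOn_rpow hH0.le hH1.le).2
  have hv : 0 < v := lt_of_lt_of_le hu huv
  have h1 := @hc u hu.le (u+v) (by simp; positivity) (u/v) (1-u/v) (by positivity) (by rw [sub_nonneg, div_le_one hv]; exact huv) (by ring)
  have h2 := @hc u hu.le (u+v) (by simp; positivity) (1-u/v) (u/v) (by rw [sub_nonneg, div_le_one hv]; exact huv) (by positivity) (by ring)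
  simp only [smul_eq_mul] at h1 h2
  have e1 : u / v * u + (1 - u / v) * (u + v) = v := by field_simp; ring
  have e2 : (1 - u / v) * u + u / v * (u + v) = 2*u := by field_simp; ring
  rw [e1] at h1
  rw [e2, Real.mul_rpow (by norm_num) hu.le] at h2
  linarith

lemma aux_rho {H s r : ℝ} (hH0 : 0 < H) (hH1 : H < 1/2) (hr : 0 < r) (hrs : r < s) :
    (2 - 2 ^ H)/4 * (r ^ (2*H) * (s-r)^(2*H)) ≤
      s ^ (2*H) * r ^ (2*H) - ((1/2) * (s ^ (2*H) + r ^ (2*H) - (s - r) ^ (2*H)))^2 := by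
  have hs : 0 < s := hr.trans hrs
  have hd : 0 < s - r := sub_pos.2 hrs
  have e : ∀ x : ℝ, 0 < x → x ^ (2*H) = (x^H)^2 := by
    intro x hx
    rw [mul_comm, Real.rpow_mul hx.le]; norm_cast
  rw [e s hs, e r hr, e _ hd]
  have hk : (0:ℝ) < 2 - 2^H := by
    have : (2:ℝ)^H < 2^(1:ℝ) := Real.rpow_lt_rpow_of_exponent_lt (by norm_num) (by linarith)
    rw [Real.rpow_one] at this; linarith
  set k := (2:ℝ) - 2^H
  have hsr : r^H ≤ s^H := Real.rpow_le_rpow hr.le hrs.le hH0.le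
  have hsd : (s-r)^H ≤ s^H := Real.rpow_le_rpow hd.le (by linarith) hH0.le
  have p1 : 0 < r^H := by positivity
  have p2 : 0 < (s-r)^H := by positivity
  have p3 : 0 < s^H := by positivity
  have key : k * (r^H * (s-r)^H) ≤ ((s-r)^H + r^H - s^H) * s^H := by
    rcases le_total r (s-r) with h | h
    · have := aux_conc hH0 (by linarith) hr h
      rw [show r + (s-r) = s by ring] at this
      calc k * (r^H * (s-r)^H) = (k * r^H) * (s-r)^H := by ring
        _ ≤ ((s-r)^H + r^H - s^H) * s^H := by
          apply mul_le_mul _ hsd p2.le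
          · nlinarith [mul_pos hk p1]
          · linarith
    · have := aux_conc hH0 (by linarith) hd h
      rw [show (s-r) + r = s by ring] at this
      calc k * (r^H * (s-r)^H) = (k * (s-r)^H) * r^H := by ring
        _ ≤ ((s-r)^H + r^H - s^H) * s^H := by
          apply mul_le_mul _ hsr p1.le
          · nlinarith [mul_pos hk p2]
          · linarith
  generalize r^H = b at *
  generalize s^H = a at *
  generalize (s-r)^H = d at *
  have hq : 0 < d + b - a := by
    by_contra hh
    have : (d+b-a)*a ≤ 0 := mul_nonpos_of_nonpos_of_nonneg (not_lt.1 hh) p3.le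
    have := mul_pos hk (mul_pos p1 p2)
    linarith
  have : a^2*b^2 - (1/2*(a^2+b^2-d^2))^2 = (d+b-a)*(d+(a-b))*((a+b-d)*(a+b+d))/4 := by ring
  rw [this]
  have h1 : d * b * a ≤ (d+(a-b))*((a+b-d)*(a+b+d)) := by
    rw [mul_assoc]
    apply mul_le_mul (by linarith) _ (by positivity) (by linarith)
    apply mul_le_mul (by linarith) (by linarith) p3.le (by linarith)
  have h2 := mul_le_mul_of_nonneg_left h1 hq.le
  have h3 := mul_le_mul_of_nonneg_right key (mul_pos p1 p2).le
  nlinarith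

lemma aux_ibp {f g g' g'' : ℝ → ℝ} (hf : ContDiff ℝ 2 f) (hc : HasCompactSupport f)
    (hg : ∀ x, HasDerivAt g (g' x) x) (hg' : ∀ x, HasDerivAt g' (g'' x) x) (hg'' : Continuous g'') :
    ∫ x, deriv (deriv f) x * g x = ∫ x, f x * g'' x := by
  have hf1 : ContDiff ℝ 1 (deriv f) := by
    have : ContDiff ℝ (1+1) f := by simpa [one_add_one_eq_two] using hf
    exact (contDiff_succ_iff_deriv.1 this).2.2
  have c0 : Continuous f := hf.continuous
  have c1 : Continuous (deriv f) := hf1.continuous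
  have c2 : Continuous (deriv (deriv f)) := hf1.continuous_deriv le_rfl
  have k1 : HasCompactSupport (deriv f) := hc.deriv
  have k2 : HasCompactSupport (deriv (deriv f)) := k1.deriv
  have d0 : ∀ x, HasDerivAt f (deriv f x) x := fun x =>
    (hf.differentiable (by norm_num) x).hasDerivAt
  have d1 : ∀ x, HasDerivAt (deriv f) (deriv (deriv f) x) x := fun x =>
    (hf1.differentiable (by norm_num) x).hasDerivAt
  have cg : Continuous g := continuous_iff_continuousAt.2 fun x => (hg x).continuousAt
  have cg' : Continuous g' := continuous_iff_continuousAt.2 fun x => (hg' x).continuousAt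
  have I : ∀ {u v : ℝ → ℝ}, Continuous u → HasCompactSupport u → Continuous v → Integrable (u * v) :=
    fun hu hk hv => (hu.mul hv).integrable_of_hasCompactSupport hk.mul_right
  have e1 := integral_mul_deriv_eq_deriv_mul_of_integrable (fun x _ => d1 x) (fun x _ => hg x)
    (I c1 k1 cg') (I c2 k2 cg) (I c1 k1 cg)
  have e2 := integral_mul_deriv_eq_deriv_mul_of_integrable (fun x _ => d0 x) (fun x _ => hg' x)
    (I c0 hc hg'') (I c1 k1 cg') (I c0 hc cg')
  rw [e2, e1, neg_neg]

lemma aux_gauss {c : ℝ} (hc : 0 < c) {K : ℝ} (hK : 0 ≤ K) (m : ℝ) :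
    ∫⁻ y : ℝ, ENNReal.ofReal (K * exp (-c * (y - m)^2)) = ENNReal.ofReal (K * √(π / c)) := by
  have hi : Integrable fun y : ℝ => exp (-c * (y - m)^2) :=
    (integrable_exp_neg_mul_sq hc).comp_sub_right m
  rw [← ofReal_integral_eq_lintegral_ofReal (hi.const_mul K)
    (Filter.Eventually.of_forall fun x => by positivity), integral_const_mul,
    integral_sub_right_eq_self (fun y : ℝ => exp (-c * y^2)) m, integral_gaussian]

lemma aux_exp {t : ℝ} (ht : 0 ≤ t) : (4*t-1)^2 * exp (-(2*t)) ≤ 32 * exp (-t) := by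
  have h := quadratic_le_exp_of_nonneg ht
  have h1 : (4*t-1)^2 ≤ 32 * exp t := by nlinarith
  calc (4*t-1)^2 * exp (-(2*t)) ≤ 32 * exp t * exp (-(2*t)) := by gcongr
    _ = 32 * exp (-t) := by rw [mul_assoc, ← exp_add]; ring_nf

lemma aux_main {σ τ μ ρ : ℝ} (hσ : 0 < σ) (hτ : 0 < τ) (hρ : 0 < ρ) (h : ρ^2 = σ^2*τ^2-μ^2)
    {f : ℝ → ℝ} (hf : ContDiff ℝ 2 f) (hc : HasCompactSupport f) (φ : ℝ → ℝ → ℝ)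
    (hφ : ∀ x y, φ x y = (1/(2*π*ρ)) *
          Real.exp (-(1/(2*ρ^2)) * (τ^2 * x^2 - 2*μ*x*y + σ^2 * y^2))) :
    |∫ x : ℝ, ∫ y : ℝ, deriv (deriv f) x * f y * φ x y| ≤ 8 * (τ^2/ρ^2) *
      √((∫ x : ℝ, (f x)^2 * ((1/(√(2*π) * σ)) * exp (-x^2 / (2 * σ^2)))) *
        (∫ y : ℝ, (f y)^2 * ((1/(√(2*π) * τ)) * exp (-y^2 / (2 * τ^2))))) := by
  have hf1 : ContDiff ℝ 1 (deriv f) := by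
    have : ContDiff ℝ (1+1) f := by simpa [one_add_one_eq_two] using hf
    exact (contDiff_succ_iff_deriv.1 this).2.2
  have c0 : Continuous f := hf.continuous
  have c2 : Continuous (deriv (deriv f)) := hf1.continuous_deriv le_rfl
  have k2 : HasCompactSupport (deriv (deriv f)) := hc.deriv.deriv
  have cφ : Continuous fun p : ℝ × ℝ => φ p.1 p.2 := by
    simp only [hφ]; fun_prop
  have φpos : ∀ x y, 0 ≤ φ x y := fun x y => by rw [hφ]; positivity
  let W : ℝ → ℝ → ℝ := fun x y => ((τ^2*x-μ*y)/ρ^2)^2 - τ^2/ρ^2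
  have cW : Continuous fun p : ℝ × ℝ => W p.1 p.2 := by
    simp only [W]; fun_prop
  -- swap and integrate by parts
  have step1 : ∫ x : ℝ, ∫ y : ℝ, deriv (deriv f) x * f y * φ x y
      = ∫ y : ℝ, ∫ x : ℝ, f x * f y * (W x y * φ x y) := by
    rw [integral_integral_swap]
    · congr 1; ext y
      have hd1 : ∀ x, HasDerivAt (fun x => f y * φ x y)
          (f y * (-((τ^2*x-μ*y)/ρ^2) * φ x y)) x := by
        intro x
        have hq : HasDerivAt (fun x => -(1/(2*ρ^2)) * (τ^2 * x^2 - 2*μ*x*y + σ^2 * y^2))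
            (-(1/(2*ρ^2)) * (τ^2 * (2*x) - 2*μ*y)) x := by
          have := ((((hasDerivAt_pow 2 x).const_mul (τ^2)).sub
            (((hasDerivAt_id x).const_mul (2*μ)).mul_const y)).add_const (σ^2*y^2)).const_mul (-(1/(2*ρ^2)))
          refine this.congr_deriv ?_
          simp
        have := (hq.exp.const_mul (1/(2*π*ρ))).const_mul (f y)
        simp only [hφ]
        refine this.congr_deriv ?_
        field_simp
      have hd2 : ∀ x, HasDerivAt (fun x => f y * (-((τ^2*x-μ*y)/ρ^2) * φ x y))
          (f y * (W x y * φ x y)) x := by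
        intro x
        by_cases hy : f y = 0
        · simpa [hy] using hasDerivAt_const x (0:ℝ)
        have hl : HasDerivAt (fun x => -((τ^2*x-μ*y)/ρ^2)) (-(τ^2/ρ^2)) x := by
          have := ((((hasDerivAt_id x).const_mul (τ^2)).sub_const (μ*y)).div_const (ρ^2)).neg
          refine this.congr_deriv ?_
          simp
        have hp : HasDerivAt (fun x => φ x y) (-((τ^2*x-μ*y)/ρ^2) * φ x y) x := by
          have := (hd1 x).const_mul (f y)⁻¹
          simpa [hy] using this
        refine ((hl.mul hp).const_mul (f y)).congr_deriv ?_
        simp only [W]; ring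
      have := aux_ibp hf hc hd1 hd2 (by
        have := cW.comp (Continuous.prodMk_left y)
        have := cφ.comp (Continuous.prodMk_left y)
        simp only [Function.comp_def] at *
        fun_prop)
      simpa only [mul_assoc] using this
    · apply Continuous.integrable_of_hasCompactSupport
      · simp only [Function.uncurry_def]; fun_prop
      · refine HasCompactSupport.intro (k2.isCompact.prod hc.isCompact) ?_
        rintro ⟨x, y⟩ hxy
        simp only [Set.mem_prod, not_and_or] at hxy
        rcases hxy with hx | hx
        · simp [Function.uncurry, image_eq_zero_of_notMem_tsupport hx]
        · simp [Function.uncurry, image_eq_zero_of_notMem_tsupport hx]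
  rw [step1]
  set P := ∫ x : ℝ, (f x)^2 * ((1/(√(2*π) * σ)) * exp (-x^2 / (2 * σ^2))) with hP
  set Q := ∫ y : ℝ, (f y)^2 * ((1/(√(2*π) * τ)) * exp (-y^2 / (2 * τ^2))) with hQ
  have P0 : 0 ≤ P := integral_nonneg fun x => by positivity
  have Q0 : 0 ≤ Q := integral_nonneg fun x => by positivity
  have Iw : ∀ (w : ℝ → ℝ), Continuous w → Integrable fun x => (f x)^2 * w x := fun w hw =>
    ((c0.pow 2).mul hw).integrable_of_hasCompactSupport (by
      have : HasCompactSupport (fun x => f x * (f x * w x)) := hc.mul_right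
      refine HasCompactSupport.mul_right ?_
      simpa [pow_two] using hc.mul_right (f' := f))
  have PE : ENNReal.ofReal P = ∫⁻ x : ℝ, ENNReal.ofReal ((f x)^2 * ((1/(√(2*π) * σ)) * exp (-x^2 / (2 * σ^2)))) :=
    ofReal_integral_eq_lintegral_ofReal (Iw _ (by fun_prop))
      (Filter.Eventually.of_forall fun x => by positivity)
  have QE : ENNReal.ofReal Q = ∫⁻ y : ℝ, ENNReal.ofReal ((f y)^2 * ((1/(√(2*π) * τ)) * exp (-y^2 / (2 * τ^2)))) :=
    ofReal_integral_eq_lintegral_ofReal (Iw _ (by fun_prop))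
      (Filter.Eventually.of_forall fun x => by positivity)
  let g1 : ℝ × ℝ → ENNReal := fun p => ENNReal.ofReal (|f p.1| * √(φ p.1 p.2))
  let g2 : ℝ × ℝ → ENNReal := fun p => ENNReal.ofReal (|f p.2| * |W p.1 p.2| * √(φ p.1 p.2))
  have m1 : Measurable g1 := by
    apply Measurable.ennreal_ofReal; apply Continuous.measurable; fun_prop
  have m2 : Measurable g2 := by
    apply Measurable.ennreal_ofReal; apply Continuous.measurable; fun_prop
  have s1 : ∀ p, g1 p ^ (2:ℝ) = ENNReal.ofReal ((f p.1)^2 * φ p.1 p.2) := by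
    intro p
    simp only [g1]
    rw [ENNReal.rpow_ofNat, ← ENNReal.ofReal_pow (by positivity), mul_pow, sq_abs, sq_sqrt (φpos _ _)]
  have s2 : ∀ p, g2 p ^ (2:ℝ) = ENNReal.ofReal ((f p.2)^2 * (W p.1 p.2)^2 * φ p.1 p.2) := by
    intro p
    simp only [g2]
    rw [ENNReal.rpow_ofNat, ← ENNReal.ofReal_pow (by positivity), mul_pow, mul_pow, sq_abs, sq_abs, sq_sqrt (φpos _ _)]
  have n1 : ∫⁻ p, g1 p ^ (2:ℝ) ∂(volume.prod volume) = ENNReal.ofReal P := by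
    rw [lintegral_prod _ (by fun_prop), PE]
    congr 1; ext x
    simp only [s1]
    have := aux_gauss (c := σ^2/(2*ρ^2)) (by positivity)
      (K := (f x)^2 * (1/(2*π*ρ)) * exp (-x^2 / (2 * σ^2))) (by positivity) (μ*x/σ^2)
    have hE : ∀ y, φ x y = (1/(2*π*ρ)) * (exp (-x^2 / (2 * σ^2)) *
        exp (-(σ^2/(2*ρ^2)) * (y - μ*x/σ^2)^2)) := by
      intro y
      rw [hφ, ← exp_add]
      congr 2
      field_simp
      rw [h]; ring
    refine (lintegral_congr fun y => ?_).trans (this.trans ?_)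
    · rw [hE]; congr 1; ring
    · congr 1
      have : √(π / (σ^2/(2*ρ^2))) = √(2*π) * ρ / σ := by
        rw [show π / (σ^2/(2*ρ^2)) = (2*π) * (ρ/σ)^2 by field_simp, sqrt_mul (by positivity),
          sqrt_sq (by positivity)]; ring
      rw [this]
      have h2 : √(2*π)^2 = 2*π := sq_sqrt (by positivity)
      field_simp
      rw [h2]; ring
  have n2 : ∫⁻ p, g2 p ^ (2:ℝ) ∂(volume.prod volume) ≤ ENNReal.ofReal (64 * (τ^2/ρ^2)^2 * Q) := by
    rw [lintegral_prod_symm _ (by fun_prop), ENNReal.ofReal_mul (by positivity), QE,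
      ← lintegral_const_mul _ (by apply Measurable.ennreal_ofReal; apply Continuous.measurable; fun_prop)]
    apply lintegral_mono
    intro y
    simp only [s2]
    have := aux_gauss (c := τ^2/(4*ρ^2)) (by positivity)
      (K := 32 * (τ^2/ρ^2)^2 * ((f y)^2 * (1/(2*π*ρ)) * exp (-y^2 / (2 * τ^2)))) (by positivity) (μ*y/τ^2)
    refine (lintegral_mono (fun x => ?_)).trans (this.le.trans ?_)
    · apply ENNReal.ofReal_le_ofReal
      have ht := aux_exp (t := τ^2/(4*ρ^2) * (x - μ*y/τ^2)^2) (by positivity)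
      set t := τ^2/(4*ρ^2) * (x - μ*y/τ^2)^2 with htd
      have hW : W x y = (τ^2/ρ^2) * (4*t-1) := by
        simp only [W, htd]; field_simp
      have hF : φ x y = (1/(2*π*ρ)) * exp (-y^2 / (2 * τ^2)) * exp (-(2*t)) := by
        rw [hφ, mul_assoc (1/(2*π*ρ)), ← exp_add]
        congr 2
        simp only [htd]
        field_simp
        rw [h]; ring
      rw [hW, hF, neg_mul, ← htd]
      calc _ = ((τ^2/ρ^2)^2 * ((f y)^2 * (1/(2*π*ρ)) * exp (-y^2 / (2 * τ^2)))) * ((4*t-1)^2 * exp (-(2*t))) := by ring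
        _ ≤ ((τ^2/ρ^2)^2 * ((f y)^2 * (1/(2*π*ρ)) * exp (-y^2 / (2 * τ^2)))) * (32 * exp (-t)) := by gcongr
        _ = _ := by ring
    · rw [← ENNReal.ofReal_mul (by positivity)]
      apply ENNReal.ofReal_le_ofReal
      have h3 : √(π / (τ^2/(4*ρ^2))) ≤ 2 * (√(2*π) * ρ / τ) := by
        rw [show π / (τ^2/(4*ρ^2)) = π * (2*ρ/τ)^2 by field_simp; norm_num, sqrt_mul (by positivity),
          sqrt_sq (by positivity)]
        have : √π ≤ √(2*π) := sqrt_le_sqrt (by linarith [pi_pos])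
        calc √π * (2*ρ/τ) ≤ √(2*π) * (2*ρ/τ) := by gcongr
          _ = _ := by ring
      refine (mul_le_mul_of_nonneg_left h3 (by positivity)).trans_eq ?_
      have h2 : √(2*π)^2 = 2*π := sq_sqrt (by positivity)
      field_simp
      rw [h2]; ring
  have main : ENNReal.ofReal |∫ y : ℝ, ∫ x : ℝ, f x * f y * (W x y * φ x y)| ≤
      ENNReal.ofReal (8 * (τ^2/ρ^2) * √(P*Q)) := by
    calc ENNReal.ofReal |∫ y : ℝ, ∫ x : ℝ, f x * f y * (W x y * φ x y)|
        ≤ ∫⁻ y : ℝ, ∫⁻ x : ℝ, ‖f x * f y * (W x y * φ x y)‖ₑ := by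
          rw [← Real.norm_eq_abs, ofReal_norm]
          refine (enorm_integral_le_lintegral_enorm _).trans (lintegral_mono fun y => ?_)
          exact enorm_integral_le_lintegral_enorm _
      _ = ∫⁻ y : ℝ, ∫⁻ x : ℝ, (g1 * g2) (x, y) := by
          congr 1; ext y; congr 1; ext x
          simp only [g1, g2, Pi.mul_apply]
          rw [← ENNReal.ofReal_mul (by positivity), ← ofReal_norm, Real.norm_eq_abs]
          congr 1
          rw [abs_mul, abs_mul, abs_mul, abs_of_nonneg (φpos x y)]
          nth_rewrite 1 [← mul_self_sqrt (φpos x y)]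
          ring
      _ = ∫⁻ p, (g1 * g2) p ∂(volume.prod volume) := by
          rw [lintegral_prod_symm _ (by fun_prop)]
      _ ≤ _ := ENNReal.lintegral_mul_le_Lp_mul_Lq _ Real.HolderConjugate.two_two m1.aemeasurable m2.aemeasurable
      _ ≤ (ENNReal.ofReal P)^(1/2:ℝ) * (ENNReal.ofReal (64 * (τ^2/ρ^2)^2 * Q))^(1/2:ℝ) := by
          rw [n1]; gcongr
      _ = ENNReal.ofReal (8 * (τ^2/ρ^2) * √(P*Q)) := by
          rw [ENNReal.ofReal_rpow_of_nonneg P0 (by norm_num), ENNReal.ofReal_rpow_of_nonneg (by positivity) (by norm_num),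
            ← ENNReal.ofReal_mul (by positivity), ← sqrt_eq_rpow, ← sqrt_eq_rpow]
          congr 1
          rw [show 64 * (τ^2/ρ^2)^2 * Q = (8 * (τ^2/ρ^2))^2 * Q by ring, sqrt_mul (by positivity),
            sqrt_sq (by positivity), sqrt_mul P0]
          ring
  exact (ENNReal.ofReal_le_ofReal_iff (by positivity)).1 main

theorem stmt16 (H : ℝ) (hH0 : 0 < H) (hH1 : H < 1/2) :
    ∃ C : ℝ, 0 < C ∧ ∀ s r : ℝ, 0 < r → r < s →
      ∀ f : ℝ → ℝ, ContDiff ℝ 2 f → HasCompactSupport f →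
      ∀ μ ρ : ℝ, μ = (1/2) * (s ^ (2*H) + r ^ (2*H) - (s - r) ^ (2*H)) →
        ρ = Real.sqrt (s ^ (2*H) * r ^ (2*H) - μ^2) →
      ∀ φ : ℝ → ℝ → ℝ,
        (∀ x y, φ x y = (1/(2*π*ρ)) *
          Real.exp (-(1/(2*ρ^2)) * (r ^ (2*H) * x^2 - 2*μ*x*y + s ^ (2*H) * y^2))) →
      |∫ x : ℝ, ∫ y : ℝ, deriv (deriv f) x * f y * φ x y|
        ≤ C / (s - r) ^ (2*H) *
          Real.sqrt
            ((∫ x : ℝ, (f x)^2 * ((1/(Real.sqrt (2*π) * s ^ H)) * Real.exp (-x^2 / (2 * s ^ (2*H))))) *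
             (∫ y : ℝ, (f y)^2 * ((1/(Real.sqrt (2*π) * r ^ H)) * Real.exp (-y^2 / (2 * r ^ (2*H)))))) := by
  have hk : (0:ℝ) < 2 - 2^H := by
    have : (2:ℝ)^H < 2^(1:ℝ) := Real.rpow_lt_rpow_of_exponent_lt (by norm_num) (by linarith)
    rw [Real.rpow_one] at this; linarith
  refine ⟨32 / (2 - 2^H), by positivity, ?_⟩
  intro s r hr hrs f hf hc μ ρ hμ hρ φ hφ
  have hs : 0 < s := hr.trans hrs
  have hd : 0 < s - r := sub_pos.2 hrs
  have e : ∀ x : ℝ, 0 < x → x ^ (2*H) = (x^H)^2 := by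
    intro x hx
    rw [mul_comm, Real.rpow_mul hx.le]; norm_cast
  have key := aux_rho hH0 hH1 hr hrs
  rw [← hμ] at key
  have hb : 0 < r ^ (2*H) := by positivity
  have hdd : 0 < (s-r) ^ (2*H) := by positivity
  have hpos : 0 < s ^ (2*H) * r ^ (2*H) - μ^2 := lt_of_lt_of_le (by positivity) key
  have hρ0 : 0 < ρ := by rw [hρ]; exact sqrt_pos.2 hpos
  have hρ2 : ρ^2 = s ^ (2*H) * r ^ (2*H) - μ^2 := by rw [hρ, sq_sqrt hpos.le]
  have hbound : 8 * (r ^ (2*H) / ρ^2) ≤ 32 / (2 - 2^H) / (s - r) ^ (2*H) := by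
    rw [← hρ2] at key
    rw [div_div, ← mul_div_assoc, div_le_div_iff₀ (by positivity) (by positivity)]
    nlinarith
  refine le_trans ?_ (mul_le_mul_of_nonneg_right hbound (sqrt_nonneg _))
  rw [e s hs, e r hr] at *
  exact aux_main (by positivity) (by positivity) hρ0 hρ2 hf hc φ hφ
end
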